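/- Let A = (A_1,…,A_q) be a system of endomorphisms of V. For every multi-index u ∈ ℕ^q, the following recurrence relation holds: Σ_{α=1}^q Σ_{β=1}^q tr( A_α ∘ A_β ∘ T_{β♭α♭(u)}(A) ) = −|u|·σ_u(A) + Σ_{α=1}^q tr(A_α)·σ_{α♭(u)}(A), where β♭α♭(u) denotes u with both its α-th and β-th entries decreased by 1. -/

import Mathlib

open scoped BigOperators

namespace GNTPaper

variable {p q : ℕ}

/-- The Newton polynomial `P_A(t) = det(1_V + tA)` of a system of endomorphisms
(represented as matrices w.r.t. an orthonormal basis), as a multivariate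
polynomial in the variables `t_1, …, t_q`. -/
noncomputable def newtonMvPoly (A : Fin q → Matrix (Fin p) (Fin p) ℝ) :
    MvPolynomial (Fin q) ℝ :=
  Matrix.det (1 + ∑ α : Fin q, (MvPolynomial.X α : MvPolynomial (Fin q) ℝ) •
    (A α).map (fun x => (MvPolynomial.C x : MvPolynomial (Fin q) ℝ)))

/-- `σ_u(A)`: the coefficient of `t^u` in the Newton polynomial `P_A(t) = det(1 + tA)`. -/
noncomputable def sigma (A : Fin q → Matrix (Fin p) (Fin p) ℝ) (u : Fin q → ℕ) : ℝ :=
  MvPolynomial.coeff (Finsupp.equivFunOnFinite.symm u) (newtonMvPoly A)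

/-- A matrix `i ∈ I(q,s)` (a `q × s` matrix of zeros and ones with exactly one `1`
in each column) is encoded by the function `c : Fin s → Fin q` recording, for each
column `l`, the row `c l` containing its unique entry `1`.  `wt c α` is then the
weight `|i^α| = Σ_l i^α_l`, i.e. the number of columns whose `1` lies in row `α`. -/
def wt {s : ℕ} (c : Fin s → Fin q) (α : Fin q) : ℕ :=
  (Finset.univ.filter fun l => c l = α).card

/-- The ordered composition `A^i = A_{c(1)} ⬝ A_{c(2)} ⬝ ⋯ ⬝ A_{c(s)}` associated to a
matrix `i ∈ I(q,s)` encoded by `c : Fin s → Fin q` (`A^i = 1` for `s = 0`). -/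
noncomputable def prodSeq (A : Fin q → Matrix (Fin p) (Fin p) ℝ) {s : ℕ}
    (c : Fin s → Fin q) : Matrix (Fin p) (Fin p) ℝ :=
  (List.ofFn fun l => A (c l)).prod

/-- `σ_{u - |i|}(A)`, where by convention it is `0` whenever `u - |i|` has a
negative entry. -/
noncomputable def sigmaSub (A : Fin q → Matrix (Fin p) (Fin p) ℝ) (u : Fin q → ℕ)
    {s : ℕ} (c : Fin s → Fin q) : ℝ :=
  if ∀ α, wt c α ≤ u α then sigma A (fun α => u α - wt c α) else 0

/-- The generalized Newton transformation
`T_u(A) = Σ_{s=0}^{|u|} Σ_{i ∈ I(q,s)} (-1)^{‖i‖} σ_{u-|i|}(A) A^i`. -/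
noncomputable def gnt (A : Fin q → Matrix (Fin p) (Fin p) ℝ) (u : Fin q → ℕ) :
    Matrix (Fin p) (Fin p) ℝ :=
  ∑ s ∈ Finset.range ((∑ α, u α) + 1),
    (-1 : ℝ) ^ s • ∑ c : Fin s → Fin q, sigmaSub A u c • prodSeq A c

/-- `T_{α♭(u)}(A)`, with the convention that it is `0` when `u α = 0`. -/
noncomputable def gntFlat (A : Fin q → Matrix (Fin p) (Fin p) ℝ) (α : Fin q)
    (u : Fin q → ℕ) : Matrix (Fin p) (Fin p) ℝ :=
  if u α = 0 then 0 else gnt A (Function.update u α (u α - 1))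

/-- `σ_{α♭(u)}(A)`, with the convention that it is `0` when `u α = 0`. -/
noncomputable def sigmaFlat (A : Fin q → Matrix (Fin p) (Fin p) ℝ) (α : Fin q)
    (u : Fin q → ℕ) : ℝ :=
  if u α = 0 then 0 else sigma A (Function.update u α (u α - 1))

/-- The generalized Kronecker symbol `δ^{i_1…i_r}_{j_1…j_r}`, equal to `+1` (resp. `-1`)
if the `i`'s are distinct and the `j`'s are an even (resp. odd) permutation of the `i`'s,
and `0` otherwise; given by the classical determinant formula `det(δ_{i_k j_l})_{k,l}`. -/
noncomputable def gkron {n r : ℕ} (i j : Fin r → Fin n) : ℝ :=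
  Matrix.det (Matrix.of fun k l : Fin r => if i k = j l then (1 : ℝ) else 0)

/-- For `k < 2m`, the index `⌊k/2⌋ < m`; used to pair consecutive indices. -/
def halfIdx {m : ℕ} (k : Fin (2 * m)) : Fin m :=
  ⟨(k : ℕ) / 2, Nat.div_lt_of_lt_mul k.isLt⟩

/-- The scalar `S_r(A)` (for `r = 2m` even) from Reilly's construction. -/
noncomputable def Sr (A : Fin q → Matrix (Fin p) (Fin p) ℝ) (m : ℕ) : ℝ :=
  (1 / ((2 * m).factorial : ℝ)) *
    ∑ iv : Fin (2 * m) → Fin p, ∑ jv : Fin (2 * m) → Fin p,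
      gkron iv jv * ∑ a : Fin m → Fin q, ∏ k : Fin (2 * m), A (a (halfIdx k)) (iv k) (jv k)

/-- The Reilly operator `T_r(A)` (for `r = 2m` even). -/
noncomputable def TrReilly (A : Fin q → Matrix (Fin p) (Fin p) ℝ) (m : ℕ) :
    Matrix (Fin p) (Fin p) ℝ :=
  Matrix.of fun i j => (1 / ((2 * m).factorial : ℝ)) *
    ∑ iv : Fin (2 * m) → Fin p, ∑ jv : Fin (2 * m) → Fin p,
      gkron (Fin.snoc iv i) (Fin.snoc jv j) *
        ∑ a : Fin m → Fin q, ∏ k : Fin (2 * m), A (a (halfIdx k)) (iv k) (jv k)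

/-- The Reilly operator `T_{r+1}^α(A)` (for `r = 2m` even). -/
noncomputable def Tr1Reilly (A : Fin q → Matrix (Fin p) (Fin p) ℝ) (m : ℕ) (α : Fin q) :
    Matrix (Fin p) (Fin p) ℝ :=
  Matrix.of fun i j => (1 / ((2 * m).factorial : ℝ)) *
    ∑ iv : Fin (2 * m + 1) → Fin p, ∑ jv : Fin (2 * m + 1) → Fin p,
      gkron (Fin.snoc iv i) (Fin.snoc jv j) *
        (A α (iv (Fin.last (2 * m))) (jv (Fin.last (2 * m))) *
          ∑ a : Fin m → Fin q, ∏ k : Fin (2 * m),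
            A (a (halfIdx k)) (iv k.castSucc) (jv k.castSucc))

/-- The (finite) set of multi-indices `u ∈ 2ℕ(q)` with `|u| = r` (all entries even,
total length `r`). -/
noncomputable def evenIdx (q r : ℕ) : Finset (Fin q → ℕ) :=
  (Fintype.piFinset fun _ : Fin q => Finset.range (r + 1)).filter
    fun u => (∀ α, Even (u α)) ∧ ∑ α, u α = r

theorem _root_.Derivation.leibniz_finset_prod {R S ι : Type*} [CommRing R] [CommRing S]
    [Algebra R S] [DecidableEq ι] (D : Derivation R S S) (s : Finset ι) (f : ι → S) :
    D (∏ i ∈ s, f i) = ∑ i ∈ s, (∏ j ∈ s.erase i, f j) * D (f i) := by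
  induction s using Finset.induction_on with
  | empty => simp
  | insert a s ha ih =>
    rw [Finset.prod_insert ha, D.leibniz, ih, Finset.sum_insert ha, Finset.erase_insert ha,
      smul_eq_mul, smul_eq_mul, Finset.mul_sum, add_comm]
    congr 1
    refine Finset.sum_congr rfl fun i hi => ?_
    have hia : a ≠ i := fun h => ha (h ▸ hi)
    rw [Finset.erase_insert_of_ne hia,
      Finset.prod_insert fun h => ha (Finset.mem_of_mem_erase h), mul_assoc]

/-- **Jacobi's formula** for a derivation of a commutative ring. -/
theorem _root_.Derivation.map_det {R S n : Type*} [CommRing R] [CommRing S] [Algebra R S]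
    [Fintype n] [DecidableEq n] (D : Derivation R S S) (N : Matrix n n S) :
    D N.det = (N.adjugate * N.map D).trace := by
  have hcol (i : n) : (N.adjugate * N.map D) i i = (N.updateCol i fun j => D (N j i)).det := by
    rw [← Matrix.cramer_apply, Matrix.cramer_eq_adjugate_mulVec]
    rfl
  simp only [Matrix.trace, Matrix.diag_apply, hcol, Matrix.det_apply, map_sum]
  rw [Finset.sum_comm]
  refine Finset.sum_congr rfl fun σ _ => ?_
  rw [← Finset.smul_sum, Units.smul_def, Units.smul_def, map_zsmul, D.leibniz_finset_prod]
  congr 1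
  refine Finset.sum_congr rfl fun i _ => ?_
  rw [← Finset.prod_erase_mul _ _ (Finset.mem_univ i), Matrix.updateCol_self]
  congr 1
  exact Finset.prod_congr rfl fun j hj => (Matrix.updateCol_ne (Finset.ne_of_mem_erase hj)).symm

/-- The multi-index `α♭(u)`, with truncated subtraction. -/
def flat (α : Fin q) (u : Fin q → ℕ) : Fin q → ℕ := Function.update u α (u α - 1)

theorem sum_flat_add_one {α : Fin q} {u : Fin q → ℕ} (h : u α ≠ 0) :
    ∑ β, flat α u β + 1 = ∑ β, u β := by
  rw [flat, Finset.sum_update_of_mem (Finset.mem_univ α),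
    ← Finset.sum_sdiff (Finset.subset_univ {α}), Finset.sum_singleton]
  omega

theorem wt_cons {s : ℕ} (α : Fin q) (c : Fin s → Fin q) (β : Fin q) :
    wt (Fin.cons α c : Fin (s + 1) → Fin q) β = (if α = β then 1 else 0) + wt c β := by
  simp only [wt, Finset.card_filter, Fin.sum_univ_succ, Fin.cons_zero, Fin.cons_succ]

theorem sigmaSub_cons (A : Fin q → Matrix (Fin p) (Fin p) ℝ) (u : Fin q → ℕ) {s : ℕ}
    (α : Fin q) (c : Fin s → Fin q) :
    sigmaSub A u (Fin.cons α c : Fin (s + 1) → Fin q) =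
      if u α = 0 then 0 else sigmaSub A (flat α u) c := by
  split_ifs with h
  · refine if_neg fun hle => ?_
    have := hle α
    rw [wt_cons, if_pos rfl] at this
    omega
  · have hle (β : Fin q) : wt (Fin.cons α c : Fin (s + 1) → Fin q) β ≤ u β ↔
        wt c β ≤ flat α u β := by
      rw [wt_cons, flat, Function.update_apply]
      grind
    have hsub (β : Fin q) : u β - wt (Fin.cons α c : Fin (s + 1) → Fin q) β =
        flat α u β - wt c β := by
      rw [wt_cons, flat, Function.update_apply]
      grind
    simp only [sigmaSub, hle, hsub]

theorem prodSeq_cons (A : Fin q → Matrix (Fin p) (Fin p) ℝ) {s : ℕ} (α : Fin q)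
    (c : Fin s → Fin q) :
    prodSeq A (Fin.cons α c : Fin (s + 1) → Fin q) = A α * prodSeq A c := by
  simp [prodSeq, List.ofFn_succ]

/-- The recurrence `T_u = σ_u 1 - ∑ α, A_α T_{α♭(u)}`. -/
theorem gnt_eq_sub (A : Fin q → Matrix (Fin p) (Fin p) ℝ) (u : Fin q → ℕ) :
    gnt A u = sigma A u • 1 - ∑ α, A α * gntFlat A α u := by
  have hsum (s : ℕ) : ∑ c : Fin (s + 1) → Fin q, sigmaSub A u c • prodSeq A c =
      ∑ α, ∑ c : Fin s → Fin q,
        (if u α = 0 then 0 else sigmaSub A (flat α u) c) • (A α * prodSeq A c) := by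
    rw [← Fintype.sum_prod_type', ← (Fin.consEquiv fun _ => Fin q).sum_comp]
    refine Finset.sum_congr rfl fun x _ => ?_
    rw [← sigmaSub_cons, ← prodSeq_cons]
    rfl
  have hflat (α : Fin q) : A α * gntFlat A α u = ∑ s ∈ Finset.range (∑ β, u β),
      (-1 : ℝ) ^ s • ∑ c : Fin s → Fin q,
        (if u α = 0 then 0 else sigmaSub A (flat α u) c) • (A α * prodSeq A c) := by
    unfold gntFlat
    split_ifs with h
    · simp
    · rw [← sum_flat_add_one h, gnt, Finset.mul_sum]
      simp only [Matrix.mul_smul, Finset.mul_sum, flat]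
  have hzero : ∑ c : Fin 0 → Fin q, sigmaSub A u c • prodSeq A c = sigma A u • 1 := by
    simp [sigmaSub, prodSeq, wt]
  simp only [hflat]
  rw [gnt, Finset.sum_range_succ', hzero, Finset.sum_comm, sub_eq_neg_add, pow_zero, one_smul,
    ← Finset.sum_neg_distrib]
  congr 1
  refine Finset.sum_congr rfl fun s _ => ?_
  rw [hsum, pow_succ, mul_neg_one, neg_smul, Finset.smul_sum]

/-- The matrix `1 + tA` with polynomial entries. -/
noncomputable def newtonMatrix (A : Fin q → Matrix (Fin p) (Fin p) ℝ) :
    Matrix (Fin p) (Fin p) (MvPolynomial (Fin q) ℝ) :=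
  1 + ∑ α : Fin q, (MvPolynomial.X α : MvPolynomial (Fin q) ℝ) • (A α).map MvPolynomial.C

/-- The matrix of coefficients of `t^u` in a matrix with polynomial entries. -/
noncomputable def coeffMatrix (u : Fin q → ℕ)
    (N : Matrix (Fin p) (Fin p) (MvPolynomial (Fin q) ℝ)) : Matrix (Fin p) (Fin p) ℝ :=
  N.map (MvPolynomial.coeff (Finsupp.equivFunOnFinite.symm u))

theorem coeff_X_mul_eq_ite (u : Fin q → ℕ) (α : Fin q) (f : MvPolynomial (Fin q) ℝ) :
    MvPolynomial.coeff (Finsupp.equivFunOnFinite.symm u) (MvPolynomial.X α * f) =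
      if u α = 0 then 0 else MvPolynomial.coeff (Finsupp.equivFunOnFinite.symm (flat α u)) f := by
  have hsub : Finsupp.equivFunOnFinite.symm u - Finsupp.single α 1 =
      Finsupp.equivFunOnFinite.symm (flat α u) := by
    ext β
    simp only [Finsupp.tsub_apply, Finsupp.equivFunOnFinite_symm_apply_apply, flat,
      Function.update_apply, Finsupp.single_apply]
    grind
  rw [MvPolynomial.coeff_X_mul', hsub]
  simp

theorem coeffMatrix_add (u : Fin q → ℕ)
    (N N' : Matrix (Fin p) (Fin p) (MvPolynomial (Fin q) ℝ)) :
    coeffMatrix u (N + N') = coeffMatrix u N + coeffMatrix u N' := by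
  ext; simp [coeffMatrix]

theorem coeffMatrix_sum {ι : Type*} (s : Finset ι) (u : Fin q → ℕ)
    (N : ι → Matrix (Fin p) (Fin p) (MvPolynomial (Fin q) ℝ)) :
    coeffMatrix u (∑ i ∈ s, N i) = ∑ i ∈ s, coeffMatrix u (N i) := by
  ext; simp [coeffMatrix, Matrix.sum_apply, MvPolynomial.coeff_sum]

theorem coeffMatrix_X_smul (u : Fin q → ℕ) (α : Fin q)
    (N : Matrix (Fin p) (Fin p) (MvPolynomial (Fin q) ℝ)) :
    coeffMatrix u ((MvPolynomial.X α : MvPolynomial (Fin q) ℝ) • N) =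
      if u α = 0 then 0 else coeffMatrix (flat α u) N := by
  ext i j
  simp only [coeffMatrix, Matrix.map_apply, Matrix.smul_apply, smul_eq_mul, coeff_X_mul_eq_ite]
  split_ifs <;> rfl

theorem coeffMatrix_C_mul (u : Fin q → ℕ) (B : Matrix (Fin p) (Fin p) ℝ)
    (N : Matrix (Fin p) (Fin p) (MvPolynomial (Fin q) ℝ)) :
    coeffMatrix u (B.map MvPolynomial.C * N) = B * coeffMatrix u N := by
  ext; simp [coeffMatrix, Matrix.mul_apply, MvPolynomial.coeff_sum, MvPolynomial.coeff_C_mul]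

/-- The generalized Newton transformations are the coefficients of the adjugate of `1 + tA`. -/
theorem gnt_eq_coeffMatrix_adjugate (A : Fin q → Matrix (Fin p) (Fin p) ℝ) (u : Fin q → ℕ) :
    gnt A u = coeffMatrix u (newtonMatrix A).adjugate := by
  induction hn : ∑ α, u α using Nat.strong_induction_on generalizing u with
  | _ n ih =>
    have hdet : coeffMatrix u (newtonMatrix A * (newtonMatrix A).adjugate) = sigma A u • 1 := by
      rw [Matrix.mul_adjugate]
      ext i j
      by_cases h : i = j <;>
        simp [coeffMatrix, sigma, newtonMvPoly, newtonMatrix, h]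
    conv_lhs at hdet => enter [2, 1]; rw [newtonMatrix]
    rw [add_mul, one_mul, coeffMatrix_add, Finset.sum_mul, coeffMatrix_sum] at hdet
    rw [gnt_eq_sub, ← hdet, sub_eq_iff_eq_add]
    congr 1
    refine Finset.sum_congr rfl fun α _ => ?_
    rw [Matrix.smul_mul, coeffMatrix_X_smul, gntFlat]
    split_ifs with h
    · rw [mul_zero]
    · rw [coeffMatrix_C_mul, ← ih _ (by have := sum_flat_add_one h; omega) (flat α u) rfl, flat]

/-- The Euler derivation `∑ α, t_α ∂/∂t_α` multiplies the coefficient of `t^u` by `|u|`. -/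
theorem coeff_mkDerivation_X (u : Fin q → ℕ) (f : MvPolynomial (Fin q) ℝ) :
    MvPolynomial.coeff (Finsupp.equivFunOnFinite.symm u)
        (MvPolynomial.mkDerivation ℝ (MvPolynomial.X : Fin q → MvPolynomial (Fin q) ℝ) f) =
      ((∑ α, u α : ℕ) : ℝ) * MvPolynomial.coeff (Finsupp.equivFunOnFinite.symm u) f := by
  induction f using MvPolynomial.induction_on' with
  | add f g hf hg => rw [map_add, MvPolynomial.coeff_add, MvPolynomial.coeff_add, hf, hg, mul_add]
  | monomial m r =>
    have hE : MvPolynomial.mkDerivation ℝ (MvPolynomial.X : Fin q → MvPolynomial (Fin q) ℝ)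
        (MvPolynomial.monomial m r) = ((∑ α, m α : ℕ) : ℝ) • MvPolynomial.monomial m r := by
      have hterm (α : Fin q) : MvPolynomial.monomial (m - Finsupp.single α 1) (m α : ℝ) *
          MvPolynomial.X α = (m α : ℝ) • MvPolynomial.monomial m (1 : ℝ) := by
        by_cases h : m α = 0
        · simp [h]
        · have hle : Finsupp.single α 1 ≤ m := by simpa using Nat.one_le_iff_ne_zero.2 h
          rw [MvPolynomial.X, MvPolynomial.monomial_mul, tsub_add_cancel_of_le hle,
            MvPolynomial.smul_monomial]
          simp
      rw [MvPolynomial.mkDerivation_monomial, Finsupp.sum_fintype _ _ (by simp)]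
      simp only [smul_eq_mul, hterm]
      rw [← Finset.sum_smul, smul_comm, MvPolynomial.smul_monomial, smul_eq_mul, mul_one,
        Nat.cast_sum]
    rw [hE, MvPolynomial.coeff_smul, smul_eq_mul, MvPolynomial.coeff_monomial]
    split_ifs with h
    · rw [h]; rfl
    · simp

/-- The trace identity `∑ α, tr(A_α T_{α♭(u)}) = |u| σ_u`. -/
theorem sum_trace_mul_gntFlat (A : Fin q → Matrix (Fin p) (Fin p) ℝ) (u : Fin q → ℕ) :
    ∑ α, (A α * gntFlat A α u).trace = ((∑ α, u α : ℕ) : ℝ) * sigma A u := by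
  set E := MvPolynomial.mkDerivation ℝ (MvPolynomial.X : Fin q → MvPolynomial (Fin q) ℝ) with hE
  have hmap : (newtonMatrix A).map E =
      ∑ α, (MvPolynomial.X α : MvPolynomial (Fin q) ℝ) • (A α).map MvPolynomial.C := by
    ext1 i j
    have hone : E ((1 : Matrix (Fin p) (Fin p) (MvPolynomial (Fin q) ℝ)) i j) = 0 := by
      by_cases h : i = j <;> simp [Matrix.one_apply, h]
    rw [newtonMatrix, Matrix.map_apply, Matrix.add_apply, map_add, hone, zero_add]
    simp [Matrix.sum_apply, hE, MvPolynomial.mkDerivation_X,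
      MvPolynomial.derivation_C, mul_comm]
  have htrace (N : Matrix (Fin p) (Fin p) (MvPolynomial (Fin q) ℝ)) :
      MvPolynomial.coeff (Finsupp.equivFunOnFinite.symm u) N.trace = (coeffMatrix u N).trace := by
    simp [Matrix.trace, coeffMatrix, MvPolynomial.coeff_sum]
  rw [sigma, ← coeff_mkDerivation_X, ← hE, show newtonMvPoly A = (newtonMatrix A).det from rfl,
    E.map_det, Matrix.trace_mul_comm, hmap, htrace, Finset.sum_mul, coeffMatrix_sum,
    Matrix.trace_sum]
  refine Finset.sum_congr rfl fun α _ => congrArg Matrix.trace ?_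
  rw [Matrix.smul_mul, coeffMatrix_X_smul, coeffMatrix_C_mul, gntFlat,
    gnt_eq_coeffMatrix_adjugate, flat]
  split_ifs <;> simp

theorem statement_8 (hq : 1 ≤ q) (A : Fin q → Matrix (Fin p) (Fin p) ℝ) (u : Fin q → ℕ) :
    ∑ α, ∑ β, Matrix.trace (A α * A β *
        (if u α = 0 then 0 else gntFlat A β (Function.update u α (u α - 1))))
      = -((∑ α, u α : ℕ) : ℝ) * sigma A u + ∑ α, Matrix.trace (A α) * sigmaFlat A α u := by
  rw [neg_mul, ← sum_trace_mul_gntFlat, ← Finset.sum_neg_distrib, ← Finset.sum_add_distrib]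
  refine Finset.sum_congr rfl fun α _ => ?_
  rw [← Matrix.trace_sum]
  by_cases h : u α = 0
  · simp [h, gntFlat, sigmaFlat]
  · have hrec := gnt_eq_sub A (Function.update u α (u α - 1))
    simp only [if_neg h, gntFlat.eq_def A α u, sigmaFlat, mul_assoc]
    rw [← Finset.mul_sum, ← sub_eq_iff_eq_add'.2 (sub_eq_iff_eq_add.1 hrec.symm), mul_sub,
      Matrix.trace_sub, Matrix.mul_smul, mul_one, Matrix.trace_smul, smul_eq_mul]
    ring

end GNTPaper
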